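/- arXiv:2605.29645 — 9 statements merged into one kernel-verified Lean document; each statement's English description precedes it below -/
import Mathlib

section
/- Let n be a positive integer and let a_1, …, a_n be real numbers with 0 ≤ a_i ≤ 1 for every i. Then Σ_{i=1}^n a_i / (1 + Σ_{j=1}^{i-1} a_j) ≤ 2·log(1 + Σ_{i=1}^n a_i). -/
theorem le_two_mul_log_one_add {x : ℝ} (h0 : 0 ≤ x) (h2 : x ≤ 2) :
    x ≤ 2 * Real.log (1 + x) := by
  have h_log := Real.le_log_one_add_of_nonneg h0
  have h_frac : x / 2 ≤ 2 * x / (x + 2) := by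
    rw [div_le_div_iff₀ (by norm_num) (by linarith)]
    nlinarith
  linarith

/-- Harmonic-sum inequality: for `a₁,…,aₙ ∈ [0,1]`,
`∑ᵢ aᵢ / (1 + ∑_{j<i} aⱼ) ≤ 2 log(1 + ∑ᵢ aᵢ)`. -/
theorem harmonic_sum_log_bound (n : ℕ) (hn : 0 < n) (a : ℕ → ℝ)
    (ha : ∀ i ∈ Finset.range n, 0 ≤ a i ∧ a i ≤ 1) :
    ∑ i ∈ Finset.range n, a i / (1 + ∑ j ∈ Finset.range i, a j)
      ≤ 2 * Real.log (1 + ∑ i ∈ Finset.range n, a i) := by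
  clear hn
  induction n with
  | zero => simp
  | succ n ih =>
    have h_prev : ∀ i ∈ Finset.range n, 0 ≤ a i ∧ a i ≤ 1 := fun i hi =>
      ha i (Finset.range_subset_range.2 n.le_succ hi)
    obtain ⟨h0, h1⟩ := ha n (Finset.self_mem_range_succ n)
    have h_sum : 0 ≤ ∑ i ∈ Finset.range n, a i :=
      Finset.sum_nonneg fun i hi => (h_prev i hi).1
    have h_pos : 0 < 1 + ∑ i ∈ Finset.range n, a i := by linarith
    have h_step := le_two_mul_log_one_add (div_nonneg h0 h_pos.le)
      ((div_le_iff₀ h_pos).2 (by linarith))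
    have h_log : Real.log (1 + ∑ i ∈ Finset.range (n + 1), a i) =
        Real.log (1 + ∑ i ∈ Finset.range n, a i) +
          Real.log (1 + a n / (1 + ∑ i ∈ Finset.range n, a i)) := by
      rw [← Real.log_mul h_pos.ne' (by positivity), Finset.sum_range_succ]
      congr 1
      field_simp
      ring
    rw [h_log, Finset.sum_range_succ]
    linarith [ih h_prev]
end

section
/- Let Π be a nonempty finite set, T a positive integer, η > 0, and let ℓ_1, …, ℓ_T : Π → ℝ be loss functions satisfying η·ℓ_t(π) ≥ −1 for all t ∈ {1,…,T} and π ∈ Π. Define probability distributions p_1, …, p_T on Π by: p_1 is the uniform distribution on Π, and for 1 ≤ t ≤ T−1, p_{t+1}(π) = p_t(π)·exp(−η·ℓ_t(π)) / Σ_{π'∈Π} p_t(π')·exp(−η·ℓ_t(π')). Then for every probability distribution p* on Π: Σ_{t=1}^T Σ_{π∈Π} p_t(π)·ℓ_t(π) − Σ_{t=1}^T Σ_{π∈Π} p*(π)·ℓ_t(π) ≤ log|Π|/η + η·Σ_{t=1}^T Σ_{π∈Π} p_t(π)·ℓ_t(π)². -/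
theorem Real.exp_le_one_add_add_sq {x : ℝ} (hx : x ≤ 1) : Real.exp x ≤ 1 + x + x ^ 2 := by
  rcases le_total (-1) x with h | h
  · have := (abs_le.mp (Real.abs_exp_sub_one_sub_id_le (abs_le.mpr ⟨h, hx⟩))).2
    linarith
  · have : Real.exp x ≤ 1 := Real.exp_le_one_iff.mpr (by linarith)
    nlinarith

/-- The exponential moment of a signed loss bounded below is controlled by its first two moments. -/
theorem sum_mul_exp_neg_le {α : Type*} [Fintype α] {η : ℝ} {f q : α → ℝ}
    (hf : ∀ a, -1 ≤ η * f a) (hq : ∀ a, 0 ≤ q a) (hq1 : ∑ a, q a = 1) :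
    ∑ a, q a * Real.exp (-η * f a) ≤
      Real.exp (-(η * ∑ a, q a * f a - η ^ 2 * ∑ a, q a * f a ^ 2)) := by
  calc ∑ a, q a * Real.exp (-η * f a)
      ≤ ∑ a, q a * (1 + -η * f a + (-η * f a) ^ 2) := by
        gcongr with a
        · exact hq a
        · exact Real.exp_le_one_add_add_sq (by linarith [hf a])
    _ = ∑ a, (q a - η * (q a * f a) + η ^ 2 * (q a * f a ^ 2)) :=
        Finset.sum_congr rfl fun a _ => by ring
    _ = -(η * ∑ a, q a * f a - η ^ 2 * ∑ a, q a * f a ^ 2) + 1 := by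
        rw [Finset.sum_add_distrib, Finset.sum_sub_distrib, ← Finset.mul_sum, ← Finset.mul_sum,
          hq1]
        ring
    _ ≤ _ := Real.add_one_le_exp _

/-- Hedge iterates are positive probability vectors, and the weight of each action is bounded below
in terms of its cumulative loss. -/
theorem hedge_weight_lower_bound {α : Type*} [Fintype α] [Nonempty α] {η : ℝ} {n : ℕ}
    {ℓ p : ℕ → α → ℝ} (hℓ : ∀ t < n, ∀ a, -1 ≤ η * ℓ t a)
    (hp0 : ∀ a, p 0 a = 1 / (Fintype.card α : ℝ))
    (hrec : ∀ t < n, ∀ a, p (t + 1) a = p t a * Real.exp (-η * ℓ t a) /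
      ∑ b, p t b * Real.exp (-η * ℓ t b)) {t : ℕ} (ht : t ≤ n) :
    (∀ a, 0 < p t a) ∧ ∑ a, p t a = 1 ∧
      ∀ a, Real.exp (∑ s ∈ Finset.range t,
        (η * ∑ b, p s b * ℓ s b - η ^ 2 * ∑ b, p s b * ℓ s b ^ 2 - η * ℓ s a)) /
          (Fintype.card α : ℝ) ≤ p t a := by
  induction t with
  | zero => simp [hp0, Fintype.card_pos]
  | succ t ih =>
    obtain ⟨hpos, hsum, hlow⟩ := ih (by omega)
    have hW : 0 < ∑ b, p t b * Real.exp (-η * ℓ t b) :=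
      Finset.sum_pos (fun b _ => mul_pos (hpos b) (Real.exp_pos _)) Finset.univ_nonempty
    refine ⟨fun a => ?_, ?_, fun a => ?_⟩
    · rw [hrec t ht]
      exact div_pos (mul_pos (hpos a) (Real.exp_pos _)) hW
    · simp_rw [hrec t ht]
      rw [← Finset.sum_div, div_self hW.ne']
    · rw [hrec t ht, le_div_iff₀ hW, Finset.sum_range_succ]
      refine (mul_le_mul_of_nonneg_left
        (sum_mul_exp_neg_le (hℓ t ht) (fun b => (hpos b).le) hsum) (by positivity)).trans ?_
      refine le_trans (le_of_eq ?_)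
        (mul_le_mul_of_nonneg_right (hlow a) (Real.exp_pos (-η * ℓ t a)).le)
      rw [div_mul_eq_mul_div, div_mul_eq_mul_div, ← Real.exp_add, ← Real.exp_add]
      ring_nf

/-- Second-order regret bound for Hedge with signed losses: if `η·ℓ_t(π) ≥ -1`
for all `t, π`, then the regret of exponential weights against any comparator
distribution `p⋆` is at most `log|Π|/η + η ∑_t ∑_π p_t(π) ℓ_t(π)²`.
Rounds are indexed `0,…,T-1` (so `p 0` is the uniform initial distribution). -/
theorem hedge_second_order_regret {α : Type*} [Fintype α] [Nonempty α]
    (T : ℕ) (hT : 0 < T) (η : ℝ) (hη : 0 < η) (ℓ : ℕ → α → ℝ)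
    (hℓ : ∀ t ∈ Finset.range T, ∀ π : α, -1 ≤ η * ℓ t π)
    (p : ℕ → α → ℝ)
    (hp0 : ∀ π : α, p 0 π = 1 / (Fintype.card α : ℝ))
    (hrec : ∀ t ∈ Finset.range (T - 1), ∀ π : α,
      p (t + 1) π = p t π * Real.exp (-η * ℓ t π) /
        ∑ π' : α, p t π' * Real.exp (-η * ℓ t π'))
    (pstar : α → ℝ) (hps0 : ∀ π : α, 0 ≤ pstar π) (hps1 : ∑ π : α, pstar π = 1) :
    (∑ t ∈ Finset.range T, ∑ π : α, p t π * ℓ t π)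
      - (∑ t ∈ Finset.range T, ∑ π : α, pstar π * ℓ t π)
      ≤ Real.log (Fintype.card α : ℝ) / η
        + η * ∑ t ∈ Finset.range T, ∑ π : α, p t π * (ℓ t π) ^ 2 := by
  obtain ⟨n, rfl⟩ : ∃ n, T = n + 1 := ⟨T - 1, by omega⟩
  simp only [Finset.mem_range, Nat.add_sub_cancel] at hℓ hrec
  obtain ⟨hpos, hsum, hlow⟩ :=
    hedge_weight_lower_bound (fun t ht => hℓ t (by omega)) hp0 hrec le_rfl
  have hN : (0 : ℝ) < Fintype.card α := by exact_mod_cast Fintype.card_pos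
  have key : ∀ a, ∑ s ∈ Finset.range (n + 1),
      (η * ∑ b, p s b * ℓ s b - η ^ 2 * ∑ b, p s b * ℓ s b ^ 2 - η * ℓ s a) ≤
        Real.log (Fintype.card α : ℝ) := by
    intro a
    have h := (mul_le_mul_of_nonneg_right (hlow a) (Real.exp_pos (-η * ℓ n a)).le).trans
      ((Finset.single_le_sum (f := fun b => p n b * Real.exp (-η * ℓ n b))
        (fun b _ => mul_nonneg (hpos b).le (Real.exp_pos _).le) (Finset.mem_univ a)).trans
        (sum_mul_exp_neg_le (hℓ n (by omega)) (fun b => (hpos b).le) hsum))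
    rw [div_mul_eq_mul_div, div_le_iff₀ hN, ← Real.exp_add, ← Real.exp_log hN, ← Real.exp_add,
      Real.exp_le_exp] at h
    rw [Finset.sum_range_succ]
    linarith
  have havg := Finset.sum_le_sum fun a (_ : a ∈ Finset.univ) =>
    mul_le_mul_of_nonneg_left (key a) (hps0 a)
  simp only [Finset.sum_sub_distrib, ← Finset.mul_sum, mul_sub, ← Finset.sum_mul, hps1,
    one_mul] at havg
  have hcomm : ∑ a, pstar a * (η * ∑ t ∈ Finset.range (n + 1), ℓ t a) =
      η * ∑ t ∈ Finset.range (n + 1), ∑ a, pstar a * ℓ t a := by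
    rw [Finset.sum_comm, Finset.mul_sum]
    refine Finset.sum_congr rfl fun a _ => ?_
    rw [← Finset.mul_sum]
    ring
  rw [hcomm] at havg
  rw [← sub_le_iff_le_add, le_div_iff₀ hη]
  linarith
end

section
/- Let P and Q be probability measures on a measurable space Z and let f : Z → ℝ be a measurable function with −1 ≤ f(z) ≤ 1 for all z. Then |E_P[f] − E_Q[f]| ≤ 4·√(E_Q[f²] · H²(P,Q)) + 4·H²(P,Q). -/
open MeasureTheory

/-- Squared Hellinger distance `H²(P,Q) = ½ ∫ (√(dP/dμ) − √(dQ/dμ))² dμ`,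
computed with the dominating measure `μ = P + Q`. -/
noncomputable def sqHellinger {Z : Type*} [MeasurableSpace Z] (P Q : Measure Z) : ℝ :=
  (1 / 2) * ∫ z, (Real.sqrt ((P.rnDeriv (P + Q) z).toReal)
      - Real.sqrt ((Q.rnDeriv (P + Q) z).toReal)) ^ 2 ∂(P + Q)

/-- Cauchy–Schwarz inequality for integrals of real square-integrable functions. -/
theorem sq_integral_mul_le_of_memLp_two {Z : Type*} [MeasurableSpace Z] {μ : Measure Z}
    {u v : Z → ℝ} (hu : MemLp u 2 μ) (hv : MemLp v 2 μ) :
    (∫ z, u z * v z ∂μ) ^ 2 ≤ (∫ z, u z ^ 2 ∂μ) * ∫ z, v z ^ 2 ∂μ := by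
  have huv : Integrable (fun z => u z * v z) μ := hu.integrable_mul hv
  have key : ∀ t : ℝ, 0 ≤ (∫ z, u z ^ 2 ∂μ) * (t * t) + (2 * ∫ z, u z * v z ∂μ) * t
      + ∫ z, v z ^ 2 ∂μ := by
    intro t
    have h0 : 0 ≤ ∫ z, (t * u z + v z) ^ 2 ∂μ := integral_nonneg fun z => sq_nonneg _
    have h1 : ∫ z, (t * u z + v z) ^ 2 ∂μ
        = ∫ z, (t * t * u z ^ 2 + 2 * t * (u z * v z) + v z ^ 2) ∂μ := by
      congr 1; ext z; ring
    have h2 : Integrable (fun z => t * t * u z ^ 2 + 2 * t * (u z * v z)) μ :=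
      (hu.integrable_sq.const_mul _).add (huv.const_mul _)
    rw [h1, integral_add h2 hv.integrable_sq,
      integral_add (hu.integrable_sq.const_mul _) (huv.const_mul _),
      integral_const_mul, integral_const_mul] at h0
    linarith
  have hd := discrim_le_zero key
  unfold discrim at hd
  linarith

/-- The square root of a Radon–Nikodym derivative of a finite measure is square integrable. -/
theorem memLp_two_sqrt_toReal_rnDeriv {Z : Type*} [MeasurableSpace Z] (P μ : Measure Z)
    [IsFiniteMeasure P] : MemLp (fun z => Real.sqrt (P.rnDeriv μ z).toReal) 2 μ := by
  rw [memLp_two_iff_integrable_sq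
    (P.measurable_rnDeriv μ).ennreal_toReal.sqrt.aestronglyMeasurable]
  simpa only [Real.sq_sqrt ENNReal.toReal_nonneg] using Measure.integrable_toReal_rnDeriv

/-- Expectation as an integral against the squared root density. -/
theorem integral_sq_sqrt_toReal_rnDeriv_mul {Z : Type*} [MeasurableSpace Z] {P μ : Measure Z}
    [SigmaFinite P] [SigmaFinite μ] (h : P ≪ μ) (g : Z → ℝ) :
    ∫ z, Real.sqrt (P.rnDeriv μ z).toReal ^ 2 * g z ∂μ = ∫ z, g z ∂P := by
  simpa only [Real.sq_sqrt ENNReal.toReal_nonneg, smul_eq_mul] using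
    integral_rnDeriv_smul (f := g) h

/-- Variance-sensitive comparison of means: for `f : Z → [-1,1]`,
`|E_P[f] − E_Q[f]| ≤ 4 √(E_Q[f²]·H²(P,Q)) + 4 H²(P,Q)`. -/
theorem abs_integral_sub_le_sqrt_sqHellinger {Z : Type*} [MeasurableSpace Z]
    (P Q : Measure Z) [IsProbabilityMeasure P] [IsProbabilityMeasure Q]
    (f : Z → ℝ) (hf : Measurable f) (hbd : ∀ z, -1 ≤ f z ∧ f z ≤ 1) :
    |(∫ z, f z ∂P) - ∫ z, f z ∂Q|
      ≤ 4 * Real.sqrt ((∫ z, (f z) ^ 2 ∂Q) * sqHellinger P Q)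
        + 4 * sqHellinger P Q := by
  have hP : P ≪ P + Q := Measure.AbsolutelyContinuous.rfl.add_right Q
  have hQ : Q ≪ P + Q := by
    rw [add_comm]
    exact Measure.AbsolutelyContinuous.rfl.add_right P
  have hPf := integral_sq_sqrt_toReal_rnDeriv_mul hP f
  have hQf := integral_sq_sqrt_toReal_rnDeriv_mul hQ f
  have hQf2 := integral_sq_sqrt_toReal_rnDeriv_mul hQ fun z => f z ^ 2
  have ha := memLp_two_sqrt_toReal_rnDeriv P (P + Q)
  have hb := memLp_two_sqrt_toReal_rnDeriv Q (P + Q)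
  unfold sqHellinger
  rw [← hPf, ← hQf, ← hQf2]
  set a : Z → ℝ := fun z => Real.sqrt (P.rnDeriv (P + Q) z).toReal
  set b : Z → ℝ := fun z => Real.sqrt (Q.rnDeriv (P + Q) z).toReal
  set μ := P + Q
  change |(∫ z, a z ^ 2 * f z ∂μ) - ∫ z, b z ^ 2 * f z ∂μ|
    ≤ 4 * Real.sqrt ((∫ z, b z ^ 2 * f z ^ 2 ∂μ) * ((1 / 2) * ∫ z, (a z - b z) ^ 2 ∂μ))
      + 4 * ((1 / 2) * ∫ z, (a z - b z) ^ 2 ∂μ)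
  have hf1 : ∀ z, |f z| ≤ 1 := fun z => abs_le.2 (hbd z)
  have hfbd : ∀ᵐ z ∂μ, ‖f z‖ ≤ 1 := Filter.Eventually.of_forall hf1
  have hv : MemLp (fun z => a z - b z) 2 μ := ha.sub hb
  have hu : MemLp (fun z => b z * f z) 2 μ := by
    refine hb.mono (hb.1.mul hf.aestronglyMeasurable) (Filter.Eventually.of_forall fun z => ?_)
    rw [norm_mul]
    exact mul_le_of_le_one_right (norm_nonneg _) (hf1 z)
  have hu2 : ∫ z, b z ^ 2 * f z ^ 2 ∂μ = ∫ z, (b z * f z) ^ 2 ∂μ := by simp only [mul_pow]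
  have hvf : Integrable (fun z => (a z - b z) ^ 2 * f z) μ :=
    hv.integrable_sq.mul_bdd (c := 1) hf.aestronglyMeasurable hfbd
  have huv : Integrable (fun z => b z * f z * (a z - b z)) μ := hu.integrable_mul hv
  have hsplit : (∫ z, a z ^ 2 * f z ∂μ) - ∫ z, b z ^ 2 * f z ∂μ
      = (∫ z, (a z - b z) ^ 2 * f z ∂μ) + 2 * ∫ z, b z * f z * (a z - b z) ∂μ := by
    rw [← integral_sub (ha.integrable_sq.mul_bdd (c := 1) hf.aestronglyMeasurable hfbd)
      (hb.integrable_sq.mul_bdd (c := 1) hf.aestronglyMeasurable hfbd),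
      ← integral_const_mul, ← integral_add hvf (huv.const_mul 2)]
    congr 1; ext z; ring
  have hcs := sq_integral_mul_le_of_memLp_two hu hv
  have hfirst : |∫ z, (a z - b z) ^ 2 * f z ∂μ| ≤ ∫ z, (a z - b z) ^ 2 ∂μ := by
    rw [← Real.norm_eq_abs]
    refine norm_integral_le_of_norm_le hv.integrable_sq (Filter.Eventually.of_forall fun z => ?_)
    rw [norm_mul, Real.norm_of_nonneg (sq_nonneg _)]
    exact mul_le_of_le_one_right (sq_nonneg _) (hf1 z)
  have hA : 0 ≤ ∫ z, (b z * f z) ^ 2 ∂μ := integral_nonneg fun z => sq_nonneg _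
  have hC : 0 ≤ ∫ z, (a z - b z) ^ 2 ∂μ := integral_nonneg fun z => sq_nonneg _
  rw [hu2, hsplit]
  generalize (∫ z, (b z * f z) ^ 2 ∂μ) = A at *
  generalize (∫ z, (a z - b z) ^ 2 ∂μ) = C at *
  generalize (∫ z, b z * f z * (a z - b z) ∂μ) = B at *
  have hAC : 0 ≤ A * C := mul_nonneg hA hC
  have hB : |B| / 2 ≤ Real.sqrt (A * (1 / 2 * C)) := by
    apply Real.le_sqrt_of_sq_le
    rw [div_pow, sq_abs]
    linarith
  refine (abs_add_le _ _).trans ?_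
  rw [abs_mul, abs_two]
  linarith
end

section
/- Let P and Q be probability measures on a measurable space Z and let f : Z → ℝ be a measurable function with E_P[f²] < ∞ and E_Q[f²] < ∞. Then (E_P[f] − E_Q[f])² ≤ 4·H²(P,Q)·(E_P[f²] + E_Q[f²]). -/
open MeasureTheory

/-- Cauchy–Schwarz inequality for integrals of real-valued functions. -/
theorem sq_integral_mul_le_integral_sq_mul_integral_sq {α : Type*} [MeasurableSpace α]
    {μ : Measure α} {u v : α → ℝ} (hu : MemLp u 2 μ) (hv : MemLp v 2 μ) :
    (∫ x, u x * v x ∂μ) ^ 2 ≤ (∫ x, u x ^ 2 ∂μ) * ∫ x, v x ^ 2 ∂μ := by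
  have huv : Integrable (fun x => u x * v x) μ := hu.integrable_mul hv
  have hu2 := hu.integrable_sq
  have hv2 := hv.integrable_sq
  have key : ∀ t : ℝ, 0 ≤ (∫ x, u x ^ 2 ∂μ) * (t * t) + (2 * ∫ x, u x * v x ∂μ) * t
      + ∫ x, v x ^ 2 ∂μ := by
    intro t
    have h : ∫ x, (t * u x + v x) ^ 2 ∂μ = (∫ x, u x ^ 2 ∂μ) * (t * t)
        + (2 * ∫ x, u x * v x ∂μ) * t + ∫ x, v x ^ 2 ∂μ := by
      have h₁ : Integrable (fun x => u x ^ 2 * (t * t)) μ := hu2.mul_const _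
      have h₂ : Integrable (fun x => 2 * (u x * v x) * t) μ := (huv.const_mul _).mul_const _
      have h₁₂ : Integrable (fun x => u x ^ 2 * (t * t) + 2 * (u x * v x) * t) μ := h₁.add h₂
      rw [← integral_mul_const, ← integral_const_mul, ← integral_mul_const,
        ← integral_add h₁ h₂, ← integral_add h₁₂ hv2]
      congr 1 with x
      ring
    rw [← h]
    exact integral_nonneg fun x => sq_nonneg _
  have := discrim_le_zero key
  unfold discrim at this
  linarith

/-- Second-moment comparison of integrals against two nonnegative densities `p` and `q`. -/
theorem sq_integral_mul_sub_integral_mul_le {α : Type*} [MeasurableSpace α] {μ : Measure α}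
    {p q f : α → ℝ} (hf : Measurable f) (hpm : Measurable p) (hqm : Measurable q)
    (hp0 : ∀ x, 0 ≤ p x) (hq0 : ∀ x, 0 ≤ q x) (hp : Integrable p μ) (hq : Integrable q μ)
    (hpf : Integrable (fun x => p x * f x) μ) (hqf : Integrable (fun x => q x * f x) μ)
    (hpf2 : Integrable (fun x => p x * f x ^ 2) μ)
    (hqf2 : Integrable (fun x => q x * f x ^ 2) μ) :
    ((∫ x, p x * f x ∂μ) - ∫ x, q x * f x ∂μ) ^ 2
      ≤ 2 * (∫ x, (√(p x) - √(q x)) ^ 2 ∂μ)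
        * ((∫ x, p x * f x ^ 2 ∂μ) + ∫ x, q x * f x ^ 2 ∂μ) := by
  have hsum : ∀ x, (√(p x) + √(q x)) ^ 2 ≤ 2 * (p x + q x) := fun x => by
    nlinarith [sq_nonneg (√(p x) - √(q x)), Real.sq_sqrt (hp0 x), Real.sq_sqrt (hq0 x)]
  have hdiff : ∀ x, (√(p x) - √(q x)) ^ 2 ≤ 2 * (p x + q x) := fun x => by
    nlinarith [sq_nonneg (√(p x) + √(q x)), Real.sq_sqrt (hp0 x), Real.sq_sqrt (hq0 x)]
  have hbound : ∀ x, ((√(p x) + √(q x)) * f x) ^ 2 ≤ 2 * (p x * f x ^ 2 + q x * f x ^ 2) :=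
    fun x => by
      rw [mul_pow]
      linarith [mul_le_mul_of_nonneg_right (hsum x) (sq_nonneg (f x))]
  have hu : MemLp (fun x => √(p x) - √(q x)) 2 μ := by
    rw [memLp_two_iff_integrable_sq (by fun_prop)]
    refine ((hp.add hq).const_mul 2).mono' (by fun_prop) (ae_of_all _ fun x => ?_)
    rw [Real.norm_of_nonneg (sq_nonneg _)]
    exact hdiff x
  have hv : MemLp (fun x => (√(p x) + √(q x)) * f x) 2 μ := by
    rw [memLp_two_iff_integrable_sq (by fun_prop)]
    refine ((hpf2.add hqf2).const_mul 2).mono' (by fun_prop) (ae_of_all _ fun x => ?_)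
    rw [Real.norm_of_nonneg (sq_nonneg _)]
    exact hbound x
  have hmul : (∫ x, p x * f x ∂μ) - ∫ x, q x * f x ∂μ
      = ∫ x, (√(p x) - √(q x)) * ((√(p x) + √(q x)) * f x) ∂μ := by
    rw [← integral_sub hpf hqf]
    congr 1 with x
    linear_combination f x * (Real.sq_sqrt (hq0 x) - Real.sq_sqrt (hp0 x))
  have hle : ∫ x, ((√(p x) + √(q x)) * f x) ^ 2 ∂μ
      ≤ 2 * ((∫ x, p x * f x ^ 2 ∂μ) + ∫ x, q x * f x ^ 2 ∂μ) := by
    rw [← integral_add hpf2 hqf2, ← integral_const_mul]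
    exact integral_mono hv.integrable_sq ((hpf2.add hqf2).const_mul 2) hbound
  rw [hmul]
  refine (sq_integral_mul_le_integral_sq_mul_integral_sq hu hv).trans ?_
  have := mul_le_mul_of_nonneg_left hle
    (integral_nonneg fun x => sq_nonneg (√(p x) - √(q x)) : 0 ≤ ∫ x, (√(p x) - √(q x)) ^ 2 ∂μ)
  linarith

/-- Second-moment comparison of means:
`(E_P[f] − E_Q[f])² ≤ 4 H²(P,Q) (E_P[f²] + E_Q[f²])` for square-integrable `f`. -/
theorem sq_integral_sub_le_sqHellinger {Z : Type*} [MeasurableSpace Z]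
    (P Q : Measure Z) [IsProbabilityMeasure P] [IsProbabilityMeasure Q]
    (f : Z → ℝ) (hf : Measurable f)
    (hP2 : Integrable (fun z => (f z) ^ 2) P)
    (hQ2 : Integrable (fun z => (f z) ^ 2) Q) :
    ((∫ z, f z ∂P) - ∫ z, f z ∂Q) ^ 2
      ≤ 4 * sqHellinger P Q * ((∫ z, (f z) ^ 2 ∂P) + ∫ z, (f z) ^ 2 ∂Q) := by
  have hPμ : P ≪ P + Q := Measure.AbsolutelyContinuous.rfl.add_right Q
  have hQμ : Q ≪ P + Q := by
    rw [add_comm]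
    exact Measure.AbsolutelyContinuous.rfl.add_right P
  have hP1 : Integrable f P :=
    ((memLp_two_iff_integrable_sq hf.aestronglyMeasurable).2 hP2).integrable one_le_two
  have hQ1 : Integrable f Q :=
    ((memLp_two_iff_integrable_sq hf.aestronglyMeasurable).2 hQ2).integrable one_le_two
  have h := sq_integral_mul_sub_integral_mul_le hf
    (Measure.measurable_rnDeriv P (P + Q)).ennreal_toReal
    (Measure.measurable_rnDeriv Q (P + Q)).ennreal_toReal
    (fun _ => ENNReal.toReal_nonneg) (fun _ => ENNReal.toReal_nonneg)
    Measure.integrable_toReal_rnDeriv Measure.integrable_toReal_rnDeriv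
    ((integrable_rnDeriv_smul_iff hPμ).2 hP1) ((integrable_rnDeriv_smul_iff hQμ).2 hQ1)
    ((integrable_rnDeriv_smul_iff hPμ).2 hP2) ((integrable_rnDeriv_smul_iff hQμ).2 hQ2)
  simp only [← smul_eq_mul (a := ENNReal.toReal _), integral_rnDeriv_smul hPμ,
    integral_rnDeriv_smul hQμ] at h
  unfold sqHellinger
  linarith
end

section
/- Let P and Q be probability measures on a measurable space Z and let h : Z → [0,1] be a measurable function. Then E_P[h] ≤ 3·E_Q[h] + 4·H²(P,Q). -/
open MeasureTheory

/-- Pointwise form of the change-of-measure bound, for densities `p`, `q` and a weight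
`t ∈ [0,1]`. -/
theorem mul_le_three_mul_add_sq_sqrt_sub {p q t : ℝ} (hp : 0 ≤ p) (hq : 0 ≤ q)
    (ht0 : 0 ≤ t) (ht1 : t ≤ 1) :
    p * t ≤ 3 * (q * t) + 2 * (Real.sqrt p - Real.sqrt q) ^ 2 := by
  obtain ⟨a, ha⟩ : ∃ a, a = Real.sqrt p := ⟨_, rfl⟩
  obtain ⟨b, hb⟩ : ∃ b, b = Real.sqrt q := ⟨_, rfl⟩
  have hpa : p = a ^ 2 := by rw [ha, Real.sq_sqrt hp]
  have hqb : q = b ^ 2 := by rw [hb, Real.sq_sqrt hq]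
  rw [← ha, ← hb, hpa, hqb]
  have key : a ^ 2 ≤ 3 * b ^ 2 + 2 * (a - b) ^ 2 := by
    nlinarith [sq_nonneg (a - 2 * b), sq_nonneg b]
  nlinarith [mul_le_mul_of_nonneg_right key ht0,
    mul_le_mul_of_nonneg_right ht1 (sq_nonneg (a - b))]

/-- Change-of-measure bound: for `h : Z → [0,1]`,
`E_P[h] ≤ 3 E_Q[h] + 4 H²(P,Q)`. -/
theorem integral_le_three_mul_integral_add_sqHellinger {Z : Type*} [MeasurableSpace Z]
    (P Q : Measure Z) [IsProbabilityMeasure P] [IsProbabilityMeasure Q]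
    (h : Z → ℝ) (hmeas : Measurable h) (hbd : ∀ z, 0 ≤ h z ∧ h z ≤ 1) :
    (∫ z, h z ∂P) ≤ 3 * (∫ z, h z ∂Q) + 4 * sqHellinger P Q := by
  have hP : P ≪ P + Q := Measure.AbsolutelyContinuous.rfl.add_right Q
  have hQ : Q ≪ P + Q := Measure.absolutelyContinuous_of_le (Measure.le_add_left le_rfl)
  have hnorm : ∀ᵐ z ∂(P + Q), ‖h z‖ ≤ 1 := .of_forall fun z => by
    rw [Real.norm_of_nonneg (hbd z).1]; exact (hbd z).2
  have hpi : Integrable (fun z => (P.rnDeriv (P + Q) z).toReal) (P + Q) :=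
    Measure.integrable_toReal_rnDeriv
  have hqi : Integrable (fun z => (Q.rnDeriv (P + Q) z).toReal) (P + Q) :=
    Measure.integrable_toReal_rnDeriv
  have hph := hpi.mul_bdd hmeas.aestronglyMeasurable hnorm
  have hqh := hqi.mul_bdd hmeas.aestronglyMeasurable hnorm
  have hsq : Integrable (fun z => (Real.sqrt ((P.rnDeriv (P + Q) z).toReal)
      - Real.sqrt ((Q.rnDeriv (P + Q) z).toReal)) ^ 2) (P + Q) := by
    refine (hpi.add hqi).mono' ?_ (.of_forall fun z => ?_)
    · exact ((((Measure.measurable_rnDeriv P (P + Q)).ennreal_toReal.sqrt).sub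
        ((Measure.measurable_rnDeriv Q (P + Q)).ennreal_toReal.sqrt)).pow_const 2)
          |>.aestronglyMeasurable
    · rw [Real.norm_of_nonneg (sq_nonneg _), Pi.add_apply]
      have h1 := Real.sq_sqrt (ENNReal.toReal_nonneg (a := P.rnDeriv (P + Q) z))
      have h2 := Real.sq_sqrt (ENNReal.toReal_nonneg (a := Q.rnDeriv (P + Q) z))
      nlinarith [mul_nonneg (Real.sqrt_nonneg (P.rnDeriv (P + Q) z).toReal)
        (Real.sqrt_nonneg (Q.rnDeriv (P + Q) z).toReal)]
  have hmono := integral_mono hph ((hqh.const_mul 3).add (hsq.const_mul 2)) fun z =>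
    mul_le_three_mul_add_sq_sqrt_sub ENNReal.toReal_nonneg ENNReal.toReal_nonneg
      (hbd z).1 (hbd z).2
  rw [integral_add' (hqh.const_mul 3) (hsq.const_mul 2), integral_const_mul,
    integral_const_mul] at hmono
  have eP := integral_rnDeriv_smul (f := h) hP
  have eQ := integral_rnDeriv_smul (f := h) hQ
  simp only [smul_eq_mul] at eP eQ
  rw [eP, eQ] at hmono
  unfold sqHellinger
  linarith
end

section
/- Let (Ω, F, P) be a probability space with a filtration F_0 ⊆ F_1 ⊆ … ⊆ F_T, let B > 0, and let X_1, …, X_T be a martingale difference sequence with respect to this filtration: each X_t is F_t-measurable, |X_t| ≤ B almost surely, and E[X_t | F_{t−1}] = 0 almost surely. Let S = Σ_{t=1}^T X_t and V = Σ_{t=1}^T E[X_t² | F_{t−1}]. Then for every δ ∈ (0,1) and every a ≥ 1: P( S ≤ V/(a·B) + a·B·log(1/δ) ) ≥ 1 − δ. -/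
open MeasureTheory

/-- If `Y` has conditional mean zero and `|Y| ≤ 1` almost surely, then multiplying by
`exp (Y - E[Y ^ 2 | m₀])` does not increase the integral of a nonnegative `m₀`-measurable
function. -/
lemma integrable_and_integral_mul_exp_sub_condExp_sq_le {Ω : Type*} {m₀ m : MeasurableSpace Ω}
    (hm : m₀ ≤ m) {P : Measure Ω} [IsProbabilityMeasure P] {M Y : Ω → ℝ}
    (hM : StronglyMeasurable[m₀] M) (hM_nonneg : 0 ≤ M) (hM_int : Integrable M P)
    (hY : StronglyMeasurable Y) (hY_bdd : ∀ᵐ ω ∂P, |Y ω| ≤ 1) (hY_mean : P[Y | m₀] =ᵐ[P] 0) :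
    Integrable (fun ω ↦ M ω * Real.exp (Y ω - (P[Y ^ 2 | m₀]) ω)) P ∧
      ∫ ω, M ω * Real.exp (Y ω - (P[Y ^ 2 | m₀]) ω) ∂P ≤ ∫ ω, M ω ∂P := by
  set V : Ω → ℝ := P[Y ^ 2 | m₀]
  have hV_meas : StronglyMeasurable[m₀] V := stronglyMeasurable_condExp
  have hV_nonneg : 0 ≤ᵐ[P] V := condExp_nonneg (ae_of_all _ fun ω ↦ sq_nonneg (Y ω))
  set W : Ω → ℝ := fun ω ↦ M ω * Real.exp (-V ω) with hW
  have hW_meas : StronglyMeasurable[m₀] W :=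
    hM.mul (Real.continuous_exp.comp_stronglyMeasurable hV_meas.neg)
  have hW_nonneg : 0 ≤ W := fun ω ↦ mul_nonneg (hM_nonneg ω) (Real.exp_pos _).le
  have hW_int : Integrable W P := by
    refine hM_int.mono' (hW_meas.mono hm).aestronglyMeasurable ?_
    filter_upwards [hV_nonneg] with ω hω
    rw [Real.norm_of_nonneg (hW_nonneg ω)]
    exact mul_le_of_le_one_right (hM_nonneg ω) (Real.exp_le_one_iff.2 (neg_nonpos.2 hω))
  have hY_int : Integrable Y P :=
    Integrable.of_bound hY.aestronglyMeasurable 1 hY_bdd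
  have hY_sq_int : Integrable (Y ^ 2) P := by
    refine Integrable.of_bound (hY.pow 2).aestronglyMeasurable 1 ?_
    filter_upwards [hY_bdd] with ω hω
    simpa using hω
  have hQ_int : Integrable (1 + Y + Y ^ 2) P :=
    ((integrable_const (1 : ℝ)).add hY_int).add hY_sq_int
  have hWQ_int : Integrable (W * (1 + Y + Y ^ 2)) P := by
    refine hW_int.mul_bdd (c := 3) hQ_int.aestronglyMeasurable ?_
    filter_upwards [hY_bdd] with ω hω
    have := abs_le.1 hω
    simp only [Pi.add_apply, Pi.one_apply, Pi.pow_apply, Real.norm_eq_abs]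
    rw [abs_le]
    constructor <;> nlinarith
  have hexp_int : Integrable (fun ω ↦ W ω * Real.exp (Y ω)) P := by
    refine hW_int.mul_bdd (c := Real.exp 1)
      (Real.continuous_exp.comp_stronglyMeasurable hY).aestronglyMeasurable ?_
    filter_upwards [hY_bdd] with ω hω
    rw [Real.norm_of_nonneg (Real.exp_pos _).le]
    exact Real.exp_le_exp.2 (abs_le.1 hω).2
  have hsplit : (fun ω ↦ M ω * Real.exp (Y ω - V ω)) = fun ω ↦ W ω * Real.exp (Y ω) := by
    ext ω
    rw [hW, mul_assoc, ← Real.exp_add, neg_add_eq_sub]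
  rw [hsplit]
  refine ⟨hexp_int, ?_⟩
  have hQ_condExp : P[1 + Y + Y ^ 2 | m₀] =ᵐ[P] 1 + V := by
    filter_upwards [condExp_add ((integrable_const (1 : ℝ)).add hY_int) hY_sq_int m₀,
      condExp_add (integrable_const (1 : ℝ)) hY_int m₀, hY_mean] with ω h₁ h₂ h₃
    have h₄ : (P[fun _ ↦ (1 : ℝ) | m₀]) ω = 1 := by rw [condExp_const hm]
    simp only [Pi.add_apply, Pi.zero_apply] at h₁ h₂ h₃
    refine h₁.trans ?_
    rw [h₂, h₃, h₄, add_zero]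
    rfl
  calc ∫ ω, W ω * Real.exp (Y ω) ∂P
      ≤ ∫ ω, (W * (1 + Y + Y ^ 2) : Ω → ℝ) ω ∂P := by
        refine integral_mono_ae hexp_int hWQ_int ?_
        filter_upwards [hY_bdd] with ω hω
        refine mul_le_mul_of_nonneg_left ?_ (hW_nonneg ω)
        have := (abs_le.1 (Real.abs_exp_sub_one_sub_id_le hω)).2
        simp only [Pi.add_apply, Pi.one_apply, Pi.pow_apply]
        linarith
    _ = ∫ ω, (P[W * (1 + Y + Y ^ 2) | m₀]) ω ∂P := (integral_condExp hm).symm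
    _ ≤ ∫ ω, M ω ∂P := by
        refine integral_mono_ae integrable_condExp hM_int ?_
        filter_upwards [condExp_mul_of_stronglyMeasurable_left hW_meas hWQ_int hQ_int,
          hQ_condExp] with ω h₁ h₂
        rw [h₁, Pi.mul_apply, h₂, hW, mul_assoc]
        refine mul_le_of_le_one_right (hM_nonneg ω) ?_
        calc Real.exp (-V ω) * (1 + V) ω ≤ Real.exp (-V ω) * Real.exp (V ω) := by
              refine mul_le_mul_of_nonneg_left ?_ (Real.exp_pos _).le
              simpa [add_comm] using Real.add_one_le_exp (V ω)
          _ = 1 := by rw [← Real.exp_add, neg_add_cancel, Real.exp_zero]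

/-- The exponential process attached to a martingale difference sequence bounded by one is
integrable, with integral at most one. -/
lemma integrable_and_integral_exp_sum_sub_condExp_sq_le_one {Ω : Type*} {m : MeasurableSpace Ω}
    {P : Measure Ω} [IsProbabilityMeasure P] {F : Filtration ℕ m} {Y : ℕ → Ω → ℝ} {T : ℕ}
    (hY : ∀ t ∈ Finset.Icc 1 T, StronglyMeasurable[F t] (Y t))
    (hY_bdd : ∀ t ∈ Finset.Icc 1 T, ∀ᵐ ω ∂P, |Y t ω| ≤ 1)
    (hY_mean : ∀ t ∈ Finset.Icc 1 T, P[Y t | F (t - 1)] =ᵐ[P] 0) :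
    Integrable (fun ω ↦ Real.exp
        (∑ t ∈ Finset.Icc 1 T, (Y t ω - (P[(Y t) ^ 2 | F (t - 1)]) ω))) P ∧
      ∫ ω, Real.exp (∑ t ∈ Finset.Icc 1 T, (Y t ω - (P[(Y t) ^ 2 | F (t - 1)]) ω)) ∂P ≤ 1 := by
  induction T with
  | zero => simp
  | succ n ih =>
    have hsub : Finset.Icc 1 n ⊆ Finset.Icc 1 (n + 1) := Finset.Icc_subset_Icc_right n.le_succ
    have hlast : n + 1 ∈ Finset.Icc 1 (n + 1) := by simp
    obtain ⟨hexp_int, hle⟩ := ih (fun t ht ↦ hY t (hsub ht)) (fun t ht ↦ hY_bdd t (hsub ht))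
      (fun t ht ↦ hY_mean t (hsub ht))
    have hmeas : StronglyMeasurable[F n] fun ω ↦ Real.exp
        (∑ t ∈ Finset.Icc 1 n, (Y t ω - (P[(Y t) ^ 2 | F (t - 1)]) ω)) := by
      refine Real.continuous_exp.comp_stronglyMeasurable
        (Finset.stronglyMeasurable_fun_sum _ fun t ht ↦ ?_)
      have htn : t ≤ n := (Finset.mem_Icc.1 ht).2
      exact ((hY t (hsub ht)).mono (F.mono htn)).sub
        (stronglyMeasurable_condExp.mono (F.mono ((Nat.sub_le t 1).trans htn)))
    obtain ⟨hexp_int', hle'⟩ := integrable_and_integral_mul_exp_sub_condExp_sq_le (F.le n) hmeas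
      (fun ω ↦ (Real.exp_pos _).le) hexp_int ((hY _ hlast).mono (F.le _)) (hY_bdd _ hlast)
      (hY_mean _ hlast)
    simp only [Finset.sum_Icc_succ_top (Nat.le_add_left 1 n), Real.exp_add, Nat.add_sub_cancel]
    exact ⟨hexp_int', hle'.trans hle⟩

/-- Freedman's inequality for bounded martingale difference sequences
(Theorem 1 of Beygelzimer et al., 2011): if `|X_t| ≤ B` a.s.,
`X_t` is `F_t`-measurable and `E[X_t | F_{t-1}] = 0` a.s. for `t = 1,…,T`, then with
probability at least `1 − δ`, `S ≤ V/(aB) + aB log(1/δ)`, where `S = ∑ X_t` and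
`V = ∑ E[X_t² | F_{t-1}]`. -/
theorem freedman_inequality {Ω : Type*} {m : MeasurableSpace Ω}
    (P : Measure Ω) [IsProbabilityMeasure P]
    (T : ℕ) (F : Filtration ℕ m) (B : ℝ) (hB : 0 < B)
    (X : ℕ → Ω → ℝ)
    (hmeas : ∀ t ∈ Finset.Icc 1 T, StronglyMeasurable[F t] (X t))
    (hbdd : ∀ t ∈ Finset.Icc 1 T, ∀ᵐ ω ∂P, |X t ω| ≤ B)
    (hmds : ∀ t ∈ Finset.Icc 1 T, P[X t | F (t - 1)] =ᵐ[P] 0)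
    (δ : ℝ) (hδ : δ ∈ Set.Ioo (0 : ℝ) 1) (a : ℝ) (ha : 1 ≤ a) :
    ENNReal.ofReal (1 - δ) ≤
      P {ω | ∑ t ∈ Finset.Icc 1 T, X t ω
          ≤ (∑ t ∈ Finset.Icc 1 T, (P[(X t) ^ 2 | F (t - 1)]) ω) / (a * B)
            + a * B * Real.log (1 / δ)} := by
  obtain ⟨hδ₀, -⟩ := hδ
  have hc : 0 < a * B := by positivity
  set c : ℝ := (a * B)⁻¹ with hc_def
  have hc_pos : 0 < c := inv_pos.2 hc
  have hcB : c * B ≤ 1 := by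
    rw [hc_def, inv_mul_le_iff₀ hc, mul_one]
    exact le_mul_of_one_le_left hB.le ha
  obtain ⟨hexp_int, hle⟩ := integrable_and_integral_exp_sum_sub_condExp_sq_le_one
    (P := P) (F := F) (Y := fun t ↦ c • X t) (T := T) (fun t ht ↦ (hmeas t ht).const_smul c)
    (fun t ht ↦ by
      filter_upwards [hbdd t ht] with ω hω
      rw [Pi.smul_apply, smul_eq_mul, abs_mul, abs_of_pos hc_pos]
      exact (mul_le_mul_of_nonneg_left hω hc_pos.le).trans hcB)
    (fun t ht ↦ by
      filter_upwards [condExp_smul c (X t) (F (t - 1)), hmds t ht] with ω h₁ h₂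
      rw [h₁, Pi.smul_apply, h₂, Pi.zero_apply, smul_zero])
  set Z : Ω → ℝ := fun ω ↦ ∑ t ∈ Finset.Icc 1 T,
    ((c • X t) ω - (P[(c • X t) ^ 2 | F (t - 1)]) ω) with hZ
  have hsq : ∀ᵐ ω ∂P, ∀ t ∈ Finset.Icc 1 T,
      (P[(c • X t) ^ 2 | F (t - 1)]) ω = c ^ 2 * (P[(X t) ^ 2 | F (t - 1)]) ω := by
    rw [Filter.eventually_all_finset]
    intro t _
    rw [smul_pow]
    exact condExp_smul (c ^ 2) ((X t) ^ 2) (F (t - 1))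
  have hmarkov : P {ω | 1 / δ ≤ Real.exp (Z ω)} ≤ ENNReal.ofReal δ := by
    have h := mul_meas_ge_le_integral_of_nonneg
      (ae_of_all P fun ω ↦ (Real.exp_pos (Z ω)).le) hexp_int (1 / δ)
    rw [one_div_mul_eq_div, div_le_iff₀ hδ₀] at h
    rw [← ofReal_measureReal]
    exact ENNReal.ofReal_le_ofReal (h.trans (mul_le_of_le_one_left hδ₀.le hle))
  set A : Set Ω := {ω | ∑ t ∈ Finset.Icc 1 T, X t ω
    ≤ (∑ t ∈ Finset.Icc 1 T, (P[(X t) ^ 2 | F (t - 1)]) ω) / (a * B)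
      + a * B * Real.log (1 / δ)}
  have hcompl : P Aᶜ ≤ ENNReal.ofReal δ := by
    refine (measure_mono_ae ?_).trans hmarkov
    filter_upwards [hsq] with ω hω hωA
    have hlt : (∑ t ∈ Finset.Icc 1 T, (P[(X t) ^ 2 | F (t - 1)]) ω) / (a * B)
        + a * B * Real.log (1 / δ) < ∑ t ∈ Finset.Icc 1 T, X t ω := lt_of_not_ge hωA
    have hZω : Z ω = c * (∑ t ∈ Finset.Icc 1 T, X t ω
        - (∑ t ∈ Finset.Icc 1 T, (P[(X t) ^ 2 | F (t - 1)]) ω) / (a * B)) := by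
      rw [hZ, div_eq_inv_mul, ← hc_def, mul_sub, Finset.mul_sum, ← mul_assoc, ← pow_two,
        Finset.mul_sum, ← Finset.sum_sub_distrib]
      exact Finset.sum_congr rfl fun t ht ↦ by rw [hω t ht, Pi.smul_apply, smul_eq_mul]
    change 1 / δ ≤ Real.exp (Z ω)
    rw [← Real.log_le_iff_le_exp (one_div_pos.2 hδ₀), hZω, hc_def, le_inv_mul_iff₀ hc]
    linarith
  rw [ENNReal.ofReal_sub _ hδ₀.le, ENNReal.ofReal_one, tsub_le_iff_right]
  calc (1 : ENNReal) = P (A ∪ Aᶜ) := by rw [Set.union_compl_self, measure_univ]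
    _ ≤ P A + P Aᶜ := measure_union_le _ _
    _ ≤ P A + ENNReal.ofReal δ := by gcongr
end

section
/- Let (Ω, F, P) be a probability space with a filtration F_0 ⊆ F_1 ⊆ … ⊆ F_T, let B > 0, and let X_1, …, X_T be random variables with 0 ≤ X_t ≤ B almost surely and each X_t F_t-measurable. Then for every δ ∈ (0,1) and every a ≥ 1: P( Σ_{t=1}^T X_t ≤ (1 + 1/a)·Σ_{t=1}^T E[X_t | F_{t−1}] + a·B·log(1/δ) ) ≥ 1 − δ. -/
open MeasureTheory

lemma exp_mul_le_one_add_mul {B a x : ℝ} (hB : 0 < B) (ha : 1 ≤ a) (hx0 : 0 ≤ x) (hxB : x ≤ B) :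
    Real.exp (1 / (a * B) * x) ≤ 1 + 1 / (a * B) * (1 + 1 / a) * x := by
  have ha0 : 0 < a := by linarith
  have hy0 : 0 ≤ 1 / (a * B) * x := by positivity
  have hya : 1 / (a * B) * x ≤ 1 / a := by
    calc 1 / (a * B) * x ≤ 1 / (a * B) * B := by gcongr
      _ = 1 / a := by field_simp
  have ha1 : 1 / a ≤ 1 := by rw [div_le_one ha0]; exact ha
  have h := Real.abs_exp_sub_one_sub_id_le (x := 1 / (a * B) * x)
    (by rw [abs_of_nonneg hy0]; linarith)
  have h' := (abs_le.1 h).2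
  nlinarith [mul_le_mul_of_nonneg_left hya hy0]

/-- One step of the exponential supermartingale: multiplying by `exp (l * X - c * E[X | m₀])` does
not increase the integral when `exp (l * X) ≤ 1 + c * X`. -/
lemma integrable_and_integral_mul_exp_le {Ω : Type*} {m₀ m : MeasurableSpace Ω}
    {P : Measure Ω} [IsFiniteMeasure P] (hm : m₀ ≤ m) {f X : Ω → ℝ} {B l c : ℝ}
    (hc : 0 ≤ c) (hf : StronglyMeasurable[m₀] f) (hf0 : ∀ ω, 0 ≤ f ω) (hfi : Integrable f P)
    (hX : StronglyMeasurable X) (hXB : ∀ᵐ ω ∂P, 0 ≤ X ω ∧ X ω ≤ B)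
    (hexp : ∀ x, 0 ≤ x → x ≤ B → Real.exp (l * x) ≤ 1 + c * x) :
    Integrable (fun ω ↦ f ω * Real.exp (l * X ω - c * (P[X | m₀]) ω)) P ∧
      ∫ ω, f ω * Real.exp (l * X ω - c * (P[X | m₀]) ω) ∂P ≤ ∫ ω, f ω ∂P := by
  set Y : Ω → ℝ := P[X | m₀]
  have hXbd : ∀ᵐ ω ∂P, ‖X ω‖ ≤ B := by
    filter_upwards [hXB] with ω h
    rw [Real.norm_of_nonneg h.1]
    exact h.2
  have hXi : Integrable X P := .of_bound hX.aestronglyMeasurable B hXbd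
  have hY0 : ∀ᵐ ω ∂P, 0 ≤ Y ω := condExp_nonneg (hXB.mono fun _ h ↦ h.1)
  have hYm : StronglyMeasurable[m₀] Y := stronglyMeasurable_condExp
  let W : Ω → ℝ := fun ω ↦ f ω * Real.exp (-(c * Y ω))
  have hWm : StronglyMeasurable[m₀] W :=
    hf.mul (Real.continuous_exp.comp_stronglyMeasurable (hYm.const_mul c).neg)
  have hW0 : ∀ ω, 0 ≤ W ω := fun ω ↦ mul_nonneg (hf0 ω) (Real.exp_nonneg _)
  have hWi : Integrable W P := by
    refine hfi.mono (hWm.mono hm).aestronglyMeasurable ?_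
    filter_upwards [hY0] with ω h
    rw [Real.norm_of_nonneg (hW0 ω), Real.norm_of_nonneg (hf0 ω)]
    exact mul_le_of_le_one_right (hf0 ω)
      (Real.exp_le_one_iff.2 (neg_nonpos.2 (mul_nonneg hc h)))
  have hWX : Integrable (W * X) P := hWi.mul_bdd hX.aestronglyMeasurable hXbd
  have hpull : P[W * X | m₀] =ᵐ[P] W * Y :=
    condExp_mul_of_stronglyMeasurable_left hWm hWX hXi
  have hWY : Integrable (W * Y) P := integrable_condExp.congr hpull
  have hint : ∫ ω, (W * X) ω ∂P = ∫ ω, (W * Y) ω ∂P := by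
    rw [← integral_condExp hm]
    exact integral_congr_ae hpull
  have hsplit : ∀ ω, f ω * Real.exp (l * X ω - c * Y ω) = W ω * Real.exp (l * X ω) := fun ω ↦ by
    rw [mul_assoc, ← Real.exp_add]
    ring_nf
  have hle : ∀ᵐ ω ∂P, W ω * Real.exp (l * X ω) ≤ W ω + c * (W * X) ω := by
    filter_upwards [hXB] with ω h
    calc W ω * Real.exp (l * X ω) ≤ W ω * (1 + c * X ω) :=
          mul_le_mul_of_nonneg_left (hexp _ h.1 h.2) (hW0 ω)
      _ = W ω + c * (W * X) ω := by simp only [Pi.mul_apply]; ring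
  have hdom : Integrable (fun ω ↦ W ω + c * (W * X) ω) P := hWi.add (hWX.const_mul c)
  have hmain : Integrable (fun ω ↦ W ω * Real.exp (l * X ω)) P := by
    refine hdom.mono' ((hWm.mono hm).mul
      (Real.continuous_exp.comp_stronglyMeasurable (hX.const_mul l))).aestronglyMeasurable ?_
    filter_upwards [hle] with ω h
    rwa [Real.norm_of_nonneg (mul_nonneg (hW0 ω) (Real.exp_nonneg _))]
  simp only [hsplit]
  refine ⟨hmain, ?_⟩
  calc ∫ ω, W ω * Real.exp (l * X ω) ∂P
      ≤ ∫ ω, (W ω + c * (W * X) ω) ∂P := integral_mono_ae hmain hdom hle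
    _ = ∫ ω, (W ω + c * (W * Y) ω) ∂P := by
        rw [integral_add hWi (hWX.const_mul c), integral_add hWi (hWY.const_mul c),
          integral_const_mul, integral_const_mul, hint]
    _ ≤ ∫ ω, f ω ∂P := by
        refine integral_mono (hWi.add (hWY.const_mul c)) hfi fun ω ↦ ?_
        calc W ω + c * (W * Y) ω = f ω * (Real.exp (-(c * Y ω)) * (c * Y ω + 1)) := by
              simp only [Pi.mul_apply, W]; ring
          _ ≤ f ω * (Real.exp (-(c * Y ω)) * Real.exp (c * Y ω)) := by
              have := hf0 ω
              gcongr
              exact Real.add_one_le_exp _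
          _ = f ω := by rw [← Real.exp_add]; simp

lemma integrable_and_integral_exp_sum_le_one {Ω : Type*} {m : MeasurableSpace Ω}
    {P : Measure Ω} [IsProbabilityMeasure P] {T : ℕ} {F : Filtration ℕ m} {B l c : ℝ}
    {X : ℕ → Ω → ℝ} (hc : 0 ≤ c)
    (hmeas : ∀ t ∈ Finset.Icc 1 T, StronglyMeasurable[F t] (X t))
    (hbdd : ∀ t ∈ Finset.Icc 1 T, ∀ᵐ ω ∂P, 0 ≤ X t ω ∧ X t ω ≤ B)
    (hexp : ∀ x, 0 ≤ x → x ≤ B → Real.exp (l * x) ≤ 1 + c * x) {n : ℕ} (hn : n ≤ T) :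
    Integrable (fun ω ↦ Real.exp
        (∑ t ∈ Finset.Icc 1 n, (l * X t ω - c * (P[X t | F (t - 1)]) ω))) P ∧
      ∫ ω, Real.exp
        (∑ t ∈ Finset.Icc 1 n, (l * X t ω - c * (P[X t | F (t - 1)]) ω)) ∂P ≤ 1 := by
  induction n with
  | zero => simp
  | succ n ih =>
    obtain ⟨hi, hle⟩ := ih (by omega)
    have hmem : n + 1 ∈ Finset.Icc 1 T := Finset.mem_Icc.2 ⟨by omega, hn⟩
    have hM : StronglyMeasurable[F n] (fun ω ↦ Real.exp
        (∑ t ∈ Finset.Icc 1 n, (l * X t ω - c * (P[X t | F (t - 1)]) ω))) := by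
      refine Real.continuous_exp.comp_stronglyMeasurable
        (Finset.stronglyMeasurable_fun_sum _ fun t ht ↦ ?_)
      rw [Finset.mem_Icc] at ht
      exact (((hmeas t (Finset.mem_Icc.2 ⟨ht.1, by omega⟩)).mono (F.mono ht.2)).const_mul l).sub
        ((stronglyMeasurable_condExp.mono (F.mono (by omega))).const_mul c)
    obtain ⟨hi', hle'⟩ := integrable_and_integral_mul_exp_le (F.le n) hc hM
      (fun ω ↦ Real.exp_nonneg _) hi ((hmeas _ hmem).mono (F.le _)) (hbdd _ hmem) hexp
    simp only [Finset.sum_Icc_succ_top (Nat.le_add_left 1 n), Real.exp_add, Nat.add_sub_cancel]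
    exact ⟨hi', hle'.trans hle⟩


open MeasureTheory

/-- Multiplicative Freedman-type upper-tail bound for bounded nonnegative adapted
sequences: if `0 ≤ X_t ≤ B` a.s. and `X_t` is `F_t`-measurable for `t = 1,…,T`, then
for `a ≥ 1`, with probability at least `1 − δ`,
`∑ X_t ≤ (1 + 1/a) ∑ E[X_t | F_{t-1}] + aB log(1/δ)`. -/
theorem freedman_multiplicative_upper {Ω : Type*} {m : MeasurableSpace Ω}
    (P : Measure Ω) [IsProbabilityMeasure P]
    (T : ℕ) (F : Filtration ℕ m) (B : ℝ) (hB : 0 < B)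
    (X : ℕ → Ω → ℝ)
    (hmeas : ∀ t ∈ Finset.Icc 1 T, StronglyMeasurable[F t] (X t))
    (hbdd : ∀ t ∈ Finset.Icc 1 T, ∀ᵐ ω ∂P, 0 ≤ X t ω ∧ X t ω ≤ B)
    (δ : ℝ) (hδ : δ ∈ Set.Ioo (0 : ℝ) 1) (a : ℝ) (ha : 1 ≤ a) :
    ENNReal.ofReal (1 - δ) ≤
      P {ω | ∑ t ∈ Finset.Icc 1 T, X t ω
          ≤ (1 + 1 / a) * (∑ t ∈ Finset.Icc 1 T, (P[X t | F (t - 1)]) ω)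
            + a * B * Real.log (1 / δ)} := by
  obtain ⟨hδ0, hδ1⟩ := hδ
  have ha0 : 0 < a := by linarith
  set l : ℝ := 1 / (a * B) with hl
  have hl0 : 0 < l := by positivity
  obtain ⟨hi, hle⟩ := integrable_and_integral_exp_sum_le_one (F := F)
    (c := l * (1 + 1 / a)) (by positivity) hmeas hbdd
    (fun x h0 h1 ↦ exp_mul_le_one_add_mul hB ha h0 h1) le_rfl
  set S : Ω → ℝ := fun ω ↦
    ∑ t ∈ Finset.Icc 1 T, (l * X t ω - l * (1 + 1 / a) * (P[X t | F (t - 1)]) ω) with hS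
  have hSm : Measurable S := Finset.measurable_fun_sum _ fun t ht ↦
    (((hmeas t ht).mono (F.le t)).measurable.const_mul l).sub
      ((stronglyMeasurable_condExp.mono (F.le _)).measurable.const_mul _)
  have hmarkov := mul_meas_ge_le_integral_of_nonneg
    (ae_of_all P fun ω ↦ Real.exp_nonneg (S ω)) hi (1 / δ)
  have hbad : P.real {ω | 1 / δ ≤ Real.exp (S ω)} ≤ δ := by
    rw [one_div, inv_mul_le_iff₀ hδ0, ← one_div] at hmarkov
    nlinarith
  have hmeasbad : MeasurableSet {ω | 1 / δ ≤ Real.exp (S ω)} :=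
    measurableSet_le measurable_const hSm.exp
  have hgood : 1 - δ ≤ P.real {ω | 1 / δ ≤ Real.exp (S ω)}ᶜ := by
    rw [probReal_compl_eq_one_sub hmeasbad]
    linarith
  refine (ENNReal.ofReal_le_of_le_toReal hgood).trans (measure_mono fun ω hω ↦ ?_)
  simp only [Set.mem_compl_iff, Set.mem_ofPred_eq, not_le] at hω ⊢
  have hlog : S ω < Real.log (1 / δ) := (Real.lt_log_iff_exp_lt (by positivity)).2 hω
  simp only [hS, Finset.sum_sub_distrib, ← Finset.mul_sum] at hlog
  have hmul := mul_lt_mul_of_pos_left hlog (mul_pos ha0 hB)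
  have hlaB : a * B * l = 1 := by rw [hl]; field_simp
  rw [mul_sub, ← mul_assoc, ← mul_assoc, ← mul_assoc, hlaB, one_mul, one_mul] at hmul
  linarith
end

section
/- Let (Ω, F, P) be a probability space with a filtration F_0 ⊆ F_1 ⊆ … ⊆ F_T, let B > 0, and let X_1, …, X_T be random variables with 0 ≤ X_t ≤ B almost surely and each X_t F_t-measurable. Then for every δ ∈ (0,1) and every b ≥ 1: P( Σ_{t=1}^T X_t ≥ (1 − 1/b)·Σ_{t=1}^T E[X_t | F_{t−1}] − b·B·log(1/δ) ) ≥ 1 − δ. -/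
open MeasureTheory

/-- Quadratic upper bound on `exp (-x)`, linearized on `[0, c]` with `c ≤ 1`. -/
lemma Real.exp_neg_le_one_sub_mul {x c : ℝ} (hx : 0 ≤ x) (hxc : x ≤ c) (hc : c ≤ 1) :
    Real.exp (-x) ≤ 1 - (1 - c) * x := by
  have h := Real.abs_exp_sub_one_sub_id_le (x := -x) (by rw [abs_neg, abs_of_nonneg hx]; linarith)
  have h' := (abs_le.1 h).2
  nlinarith [mul_le_mul_of_nonneg_left hxc hx]

section CondExp

variable {Ω : Type*} {m₀ m : MeasurableSpace Ω} {P : Measure Ω} [IsProbabilityMeasure P]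

/-- The conditional expectation of a function with values in `[0, B]` has values in `[0, B]`. -/
lemma MeasureTheory.condExp_mem_Icc (hm : m₀ ≤ m) {X : Ω → ℝ} {B : ℝ} (hX : Integrable X P)
    (hbdd : ∀ᵐ ω ∂P, 0 ≤ X ω ∧ X ω ≤ B) :
    ∀ᵐ ω ∂P, 0 ≤ (P[X | m₀]) ω ∧ (P[X | m₀]) ω ≤ B := by
  have h0 : 0 ≤ᵐ[P] P[X | m₀] := condExp_nonneg (hbdd.mono fun ω h => h.1)
  have hB : P[X | m₀] ≤ᵐ[P] P[fun _ => B | m₀] :=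
    condExp_mono hX (integrable_const B) (hbdd.mono fun ω h => h.2)
  rw [condExp_const hm B] at hB
  filter_upwards [h0, hB] with ω h1 h2 using ⟨h1, h2⟩

lemma MeasureTheory.integrable_exp_of_ae_le {S : Ω → ℝ} {C : ℝ} (hS : AEStronglyMeasurable S P)
    (hC : ∀ᵐ ω ∂P, S ω ≤ C) : Integrable (fun ω => Real.exp (S ω)) P := by
  refine Integrable.of_bound (Real.continuous_exp.comp_aestronglyMeasurable hS) (Real.exp C) ?_
  filter_upwards [hC] with ω h
  rw [Real.norm_eq_abs, Real.abs_exp]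
  exact Real.exp_le_exp.2 h

/-- One step of the exponential supermartingale for nonnegative bounded increments. -/
lemma MeasureTheory.integral_exp_add_condExp_sub_le (hm : m₀ ≤ m) {S X : Ω → ℝ} {B C l : ℝ}
    (hl : 0 ≤ l) (hlB : l * B ≤ 1) (hS : StronglyMeasurable[m₀] S) (hC : ∀ᵐ ω ∂P, S ω ≤ C)
    (hX : Integrable X P) (hbdd : ∀ᵐ ω ∂P, 0 ≤ X ω ∧ X ω ≤ B) :
    ∫ ω, Real.exp (S ω + l * ((1 - l * B) * (P[X | m₀]) ω - X ω)) ∂P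
      ≤ ∫ ω, Real.exp (S ω) ∂P := by
  have hμ := condExp_mem_Icc hm hX hbdd
  have ha : 0 ≤ 1 - l * B := by linarith
  set a := 1 - l * B with ha_def
  set μ := P[X | m₀] with hμ_def
  have hμm : StronglyMeasurable[m₀] μ := stronglyMeasurable_condExp
  set G : Ω → ℝ := fun ω => Real.exp (S ω + l * a * μ ω) with hG_def
  have hGS : StronglyMeasurable[m₀] (fun ω => S ω + l * a * μ ω) := hS.add (hμm.const_mul _)
  have hG : StronglyMeasurable[m₀] G := Real.continuous_exp.comp_stronglyMeasurable hGS
  have hla : 0 ≤ l * a := mul_nonneg hl ha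
  have hGC : ∀ᵐ ω ∂P, S ω + l * a * μ ω ≤ C + l * a * B := by
    filter_upwards [hC, hμ] with ω h1 h2
    exact add_le_add h1 (mul_le_mul_of_nonneg_left h2.2 hla)
  have hGi : Integrable G P := integrable_exp_of_ae_le (hGS.mono hm).aestronglyMeasurable hGC
  have hGbd : ∀ᵐ ω ∂P, ‖G ω‖ ≤ Real.exp (C + l * a * B) := by
    filter_upwards [hGC] with ω h
    rw [Real.norm_eq_abs, Real.abs_exp]
    exact Real.exp_le_exp.2 h
  have hGX : Integrable (fun ω => G ω * X ω) P :=
    hX.bdd_mul (hG.mono hm).aestronglyMeasurable hGbd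
  have hGμ : Integrable (fun ω => G ω * μ ω) P :=
    integrable_condExp.bdd_mul (hG.mono hm).aestronglyMeasurable hGbd
  have hpull : ∫ ω, G ω * X ω ∂P = ∫ ω, G ω * μ ω ∂P := by
    rw [← integral_condExp hm (f := fun ω => G ω * X ω)]
    exact integral_congr_ae (condExp_mul_of_stronglyMeasurable_left hG hGX hX)
  have hSi : Integrable (fun ω => Real.exp (S ω)) P :=
    integrable_exp_of_ae_le (hS.mono hm).aestronglyMeasurable hC
  have hleft : Integrable (fun ω => Real.exp (S ω + l * (a * μ ω - X ω))) P := by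
    refine integrable_exp_of_ae_le (C := C + l * a * B) ?_ ?_
    · exact (hS.mono hm).aestronglyMeasurable.add
        ((((hμm.mono hm).aestronglyMeasurable.const_mul a).sub hX.1).const_mul l)
    · filter_upwards [hGC, hbdd] with ω h1 h2
      nlinarith [mul_nonneg hl h2.1]
  calc ∫ ω, Real.exp (S ω + l * (a * μ ω - X ω)) ∂P
      ≤ ∫ ω, (G ω - l * a * (G ω * X ω)) ∂P := by
        refine integral_mono_ae hleft (hGi.sub (hGX.const_mul _)) ?_
        filter_upwards [hbdd] with ω h
        have h1 := Real.exp_neg_le_one_sub_mul (mul_nonneg hl h.1)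
          (mul_le_mul_of_nonneg_left h.2 hl) hlB
        have h2 : Real.exp (S ω + l * (a * μ ω - X ω)) = G ω * Real.exp (-(l * X ω)) := by
          rw [hG_def, ← Real.exp_add]
          ring_nf
        have h3 := mul_le_mul_of_nonneg_left h1 (Real.exp_nonneg (S ω + l * a * μ ω))
        change Real.exp (S ω + l * (a * μ ω - X ω)) ≤ G ω - l * a * (G ω * X ω)
        rw [h2]
        refine h3.trans_eq ?_
        rw [hG_def, ha_def]
        ring
    _ = ∫ ω, (G ω - l * a * (G ω * μ ω)) ∂P := by
        rw [integral_sub hGi (hGX.const_mul _), integral_sub hGi (hGμ.const_mul _),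
          integral_const_mul, integral_const_mul, hpull]
    _ ≤ ∫ ω, Real.exp (S ω) ∂P := by
        refine integral_mono (hGi.sub (hGμ.const_mul _)) hSi fun ω => ?_
        have h1 := Real.add_one_le_exp (-(l * a * μ ω))
        have h2 := mul_le_mul_of_nonneg_left h1 (Real.exp_nonneg (S ω + l * a * μ ω))
        rw [← Real.exp_add, add_neg_cancel_right] at h2
        refine le_trans (le_of_eq ?_) h2
        change G ω - l * a * (G ω * μ ω) = _
        rw [hG_def]
        ring

/-- The exponential process of a bounded nonnegative adapted sequence has expectation at most
one. -/
lemma MeasureTheory.integral_exp_sum_condExp_sub_le_one (F : Filtration ℕ m) {X : ℕ → Ω → ℝ}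
    {B l : ℝ} (hl : 0 ≤ l) (hlB : l * B ≤ 1) (n : ℕ)
    (hmeas : ∀ t ∈ Finset.Icc 1 n, StronglyMeasurable[F t] (X t))
    (hbdd : ∀ t ∈ Finset.Icc 1 n, ∀ᵐ ω ∂P, 0 ≤ X t ω ∧ X t ω ≤ B) :
    Integrable (fun ω => Real.exp (∑ t ∈ Finset.Icc 1 n,
        l * ((1 - l * B) * (P[X t | F (t - 1)]) ω - X t ω))) P ∧
      ∫ ω, Real.exp (∑ t ∈ Finset.Icc 1 n,
        l * ((1 - l * B) * (P[X t | F (t - 1)]) ω - X t ω)) ∂P ≤ 1 := by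
  have hXi : ∀ t ∈ Finset.Icc 1 n, Integrable (X t) P := fun t ht => by
    refine Integrable.of_bound ((hmeas t ht).mono (F.le t)).aestronglyMeasurable B ?_
    filter_upwards [hbdd t ht] with ω h
    rw [Real.norm_eq_abs, abs_of_nonneg h.1]
    exact h.2
  have key : ∀ k ≤ n,
      StronglyMeasurable[F k] (fun ω => ∑ t ∈ Finset.Icc 1 k,
        l * ((1 - l * B) * (P[X t | F (t - 1)]) ω - X t ω)) ∧
      (∃ C, ∀ᵐ ω ∂P, ∑ t ∈ Finset.Icc 1 k,
        l * ((1 - l * B) * (P[X t | F (t - 1)]) ω - X t ω) ≤ C) ∧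
      ∫ ω, Real.exp (∑ t ∈ Finset.Icc 1 k,
        l * ((1 - l * B) * (P[X t | F (t - 1)]) ω - X t ω)) ∂P ≤ 1 := by
    intro k
    induction k with
    | zero =>
      intro _
      refine ⟨?_, ⟨0, ?_⟩, ?_⟩
      · simpa using stronglyMeasurable_const
      · simp
      · simp
    | succ k ih =>
      intro hk
      obtain ⟨h1, ⟨C, hC⟩, h3⟩ := ih (by omega)
      have hmem : k + 1 ∈ Finset.Icc 1 n := Finset.mem_Icc.2 ⟨by omega, hk⟩
      simp only [Finset.sum_Icc_succ_top (Nat.le_add_left 1 k), Nat.add_sub_cancel]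
      refine ⟨?_, ⟨C + l * ((1 - l * B) * B), ?_⟩, ?_⟩
      · have hμ : StronglyMeasurable[F (k + 1)] (P[X (k + 1) | F k]) :=
          stronglyMeasurable_condExp.mono (F.mono (Nat.le_succ k))
        exact (h1.mono (F.mono (Nat.le_succ k))).add
          (((hμ.const_mul _).sub (hmeas _ hmem)).const_mul l)
      · filter_upwards [hC, condExp_mem_Icc (F.le k) (hXi _ hmem) (hbdd _ hmem),
          hbdd _ hmem] with ω hω hμ hX
        refine add_le_add hω (mul_le_mul_of_nonneg_left ?_ hl)
        have := mul_le_mul_of_nonneg_left hμ.2 (sub_nonneg.2 hlB)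
        linarith [hX.1]
      · exact (integral_exp_add_condExp_sub_le (F.le k) hl hlB h1 hC (hXi _ hmem)
          (hbdd _ hmem)).trans h3
  obtain ⟨h1, ⟨C, hC⟩, h3⟩ := key n le_rfl
  exact ⟨integrable_exp_of_ae_le (h1.mono (F.le n)).aestronglyMeasurable hC, h3⟩

end CondExp

/-- Multiplicative Freedman-type lower-tail bound for bounded nonnegative adapted
sequences: if `0 ≤ X_t ≤ B` a.s. and `X_t` is `F_t`-measurable for `t = 1,…,T`, then
for `b ≥ 1`, with probability at least `1 − δ`,
`∑ X_t ≥ (1 − 1/b) ∑ E[X_t | F_{t-1}] − bB log(1/δ)`. -/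
theorem freedman_multiplicative_lower {Ω : Type*} {m : MeasurableSpace Ω}
    (P : Measure Ω) [IsProbabilityMeasure P]
    (T : ℕ) (F : Filtration ℕ m) (B : ℝ) (hB : 0 < B)
    (X : ℕ → Ω → ℝ)
    (hmeas : ∀ t ∈ Finset.Icc 1 T, StronglyMeasurable[F t] (X t))
    (hbdd : ∀ t ∈ Finset.Icc 1 T, ∀ᵐ ω ∂P, 0 ≤ X t ω ∧ X t ω ≤ B)
    (δ : ℝ) (hδ : δ ∈ Set.Ioo (0 : ℝ) 1) (b : ℝ) (hb : 1 ≤ b) :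
    ENNReal.ofReal (1 - δ) ≤
      P {ω | (1 - 1 / b) * (∑ t ∈ Finset.Icc 1 T, (P[X t | F (t - 1)]) ω)
            - b * B * Real.log (1 / δ)
          ≤ ∑ t ∈ Finset.Icc 1 T, X t ω} := by
  obtain ⟨hδ0, hδ1⟩ := hδ
  have hb0 : 0 < b := by linarith
  have hbB : 0 < b * B := mul_pos hb0 hB
  have hlB : 1 / (b * B) * B = 1 / b := by field_simp
  have hlB1 : 1 / (b * B) * B ≤ 1 := by
    rw [hlB]
    exact (div_le_one hb0).2 hb
  obtain ⟨hint, hle⟩ := integral_exp_sum_condExp_sub_le_one (P := P) F (one_div_pos.2 hbB).le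
    hlB1 T hmeas hbdd
  rw [hlB] at hint hle
  set E : Set Ω := {ω | (1 - 1 / b) * (∑ t ∈ Finset.Icc 1 T, (P[X t | F (t - 1)]) ω)
            - b * B * Real.log (1 / δ) ≤ ∑ t ∈ Finset.Icc 1 T, X t ω} with hE
  set Z : Ω → ℝ := fun ω => Real.exp (∑ t ∈ Finset.Icc 1 T,
        1 / (b * B) * ((1 - 1 / b) * (P[X t | F (t - 1)]) ω - X t ω)) with hZ
  have hmarkov : P.real {ω | 1 / δ ≤ Z ω} ≤ δ := by
    have h := mul_meas_ge_le_integral_of_nonneg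
      (Filter.Eventually.of_forall fun ω => (Real.exp_nonneg _ : 0 ≤ Z ω)) hint (1 / δ)
    have h' := h.trans hle
    rwa [one_div, inv_mul_le_iff₀ hδ0, mul_one, ← one_div] at h'
  have hsub : Eᶜ ⊆ {ω | 1 / δ ≤ Z ω} := by
    intro ω hω
    simp only [hE, Set.mem_compl_iff, Set.mem_ofPred_eq, not_le] at hω
    have hlog : Real.log (1 / δ) ≤ ∑ t ∈ Finset.Icc 1 T,
        1 / (b * B) * ((1 - 1 / b) * (P[X t | F (t - 1)]) ω - X t ω) := by
      rw [← Finset.mul_sum, Finset.sum_sub_distrib, ← Finset.mul_sum, one_div_mul_eq_div,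
        le_div_iff₀ hbB]
      linarith
    exact (Real.log_le_iff_le_exp (one_div_pos.2 hδ0)).1 hlog
  have hcompl : P.real Eᶜ ≤ δ := (measureReal_mono hsub).trans hmarkov
  have hone : 1 ≤ P.real E + P.real Eᶜ := by
    have h := measureReal_union_le (μ := P) E Eᶜ
    rwa [Set.union_compl_self, probReal_univ] at h
  rw [ENNReal.ofReal_le_iff_le_toReal (measure_ne_top P E)]
  change 1 - δ ≤ P.real E
  linarith
end

section
/- Let A be a nonempty finite set, let (O, F) be a measurable space, let R : O → [0,1] be measurable, and let s > 0. Let M_s be the class of all models M that assign to each a ∈ A a probability measure M(a) on O and satisfy Σ_{a∈A} E_{o∼M(a)}[R(o)²] ≤ s. For M ∈ M_s write f_M(a) = E_{o∼M(a)}[R(o)] and let max_M = max_{a∈A} f_M(a). Define, for γ > 0, p-dec_γ(M_s) = sup over M̄ ∈ M_s of the infimum over probability distributions p, q on A of the supremum over M ∈ M_s of ( Σ_{a∈A} p(a)·(max_M − f_M(a)) − γ·Σ_{a∈A} q(a)·H²(M(a), M̄(a)) ). Then for every γ ≥ 32·|A| it holds that p-dec_γ(M_s) ≤ 64·s/γ.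 -/
open MeasureTheory

/-- Probability distributions on a finite set `A`. -/
def ProbVec (A : Type*) [Fintype A] : Type _ :=
  {p : A → ℝ // (∀ a, 0 ≤ p a) ∧ ∑ a, p a = 1}

/-- The class of `s`-sparse models: assignments of a probability measure `M a` on `O`
to each action `a`, with `∑_a E_{o∼M(a)}[R(o)²] ≤ s`. -/
def SparseModel {A : Type*} [Fintype A] {O : Type*} [MeasurableSpace O]
    (R : O → ℝ) (s : ℝ) : Type _ :=
  {M : A → Measure O // (∀ a, IsProbabilityMeasure (M a)) ∧
    ∑ a, (∫ o, (R o) ^ 2 ∂(M a)) ≤ s}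

theorem sqHellinger_comm {Z : Type*} [MeasurableSpace Z] (P Q : Measure Z) :
    sqHellinger P Q = sqHellinger Q P := by
  simp only [sqHellinger, add_comm Q P]
  congr 2
  ext z
  ring

theorem sqHellinger_nonneg {Z : Type*} [MeasurableSpace Z] (P Q : Measure Z) :
    0 ≤ sqHellinger P Q :=
  mul_nonneg (by norm_num) (integral_nonneg fun _ => sq_nonneg _)

theorem mul_sub_le_of_nonneg {x y f c : ℝ} (hx : 0 ≤ x) (hy : 0 ≤ y) (hc : 0 < c) :
    f * (x - y) ≤ c * (1 / 2 * (√x - √y) ^ 2) + (x * f ^ 2 + y * f ^ 2) / c := by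
  obtain ⟨a, ha⟩ : ∃ a, a = √x := ⟨_, rfl⟩
  obtain ⟨b, hb⟩ : ∃ b, b = √y := ⟨_, rfl⟩
  have hxa : x = a ^ 2 := by rw [ha, Real.sq_sqrt hx]
  have hyb : y = b ^ 2 := by rw [hb, Real.sq_sqrt hy]
  rw [← ha, ← hb, hxa, hyb, ← sub_nonneg]
  have : c * (1 / 2 * (a - b) ^ 2) + (a ^ 2 * f ^ 2 + b ^ 2 * f ^ 2) / c - f * (a ^ 2 - b ^ 2) =
      ((c * (a - b) - f * (a + b)) ^ 2 + f ^ 2 * (a - b) ^ 2) / (2 * c) := by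
    field_simp
    ring
  rw [this]
  positivity

/-- Change of measure for bounded functions, in terms of the squared Hellinger distance. -/
theorem integral_sub_integral_le_sqHellinger {Z : Type*} [MeasurableSpace Z] (P Q : Measure Z)
    [IsProbabilityMeasure P] [IsProbabilityMeasure Q] {f : Z → ℝ} (hf : Measurable f)
    (hf01 : ∀ z, f z ∈ Set.Icc (0 : ℝ) 1) {c : ℝ} (hc : 0 < c) :
    ∫ z, f z ∂P - ∫ z, f z ∂Q ≤
      c * sqHellinger P Q + (∫ z, f z ^ 2 ∂P + ∫ z, f z ^ 2 ∂Q) / c := by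
  have hbdd {μ : Measure Z} [IsFiniteMeasure μ] {g : Z → ℝ} (hg : Measurable g)
      (hg01 : ∀ z, g z ∈ Set.Icc (0 : ℝ) 1) : Integrable g μ :=
    Integrable.of_mem_Icc 0 1 hg.aemeasurable (.of_forall hg01)
  have hf2 : ∀ z, f z ^ 2 ∈ Set.Icc (0 : ℝ) 1 := fun z =>
    ⟨sq_nonneg _, pow_le_one₀ (hf01 z).1 (hf01 z).2⟩
  have hP : P ≪ P + Q := Measure.AbsolutelyContinuous.rfl.add_right Q
  have hQ : Q ≪ P + Q := by
    rw [add_comm]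
    exact Measure.AbsolutelyContinuous.rfl.add_right P
  set μ := P + Q with hμ
  have key {ν : Measure Z} [IsProbabilityMeasure ν] (hν : ν ≪ μ) {g : Z → ℝ} (hg : Measurable g)
      (hg01 : ∀ z, g z ∈ Set.Icc (0 : ℝ) 1) :
      Integrable (fun z => (ν.rnDeriv μ z).toReal * g z) μ ∧
        ∫ z, g z ∂ν = ∫ z, (ν.rnDeriv μ z).toReal * g z ∂μ :=
    ⟨(integrable_rnDeriv_smul_iff hν).2 (hbdd hg hg01), (integral_rnDeriv_smul hν).symm⟩
  obtain ⟨iP, eP⟩ := key hP hf hf01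
  obtain ⟨iQ, eQ⟩ := key hQ hf hf01
  obtain ⟨iP2, eP2⟩ := key hP (hf.pow_const 2) hf2
  obtain ⟨iQ2, eQ2⟩ := key hQ (hf.pow_const 2) hf2
  have iS : Integrable (fun z => ((P.rnDeriv μ z).toReal * f z ^ 2 +
      (Q.rnDeriv μ z).toReal * f z ^ 2) / c) μ := (iP2.add iQ2).div_const c
  have iH : Integrable (fun z => (√(P.rnDeriv μ z).toReal - √(Q.rnDeriv μ z).toReal) ^ 2) μ := by
    refine ((Measure.integrable_toReal_rnDeriv (μ := P) (ν := μ)).add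
      (Measure.integrable_toReal_rnDeriv (μ := Q) (ν := μ))).mono'
      (Measurable.aestronglyMeasurable (by fun_prop)) (.of_forall fun z => ?_)
    have hx := Real.sq_sqrt (ENNReal.toReal_nonneg (a := P.rnDeriv μ z))
    have hy := Real.sq_sqrt (ENNReal.toReal_nonneg (a := Q.rnDeriv μ z))
    rw [Real.norm_of_nonneg (sq_nonneg _), Pi.add_apply]
    nlinarith [mul_nonneg (Real.sqrt_nonneg (P.rnDeriv μ z).toReal)
      (Real.sqrt_nonneg (Q.rnDeriv μ z).toReal)]
  rw [sqHellinger, ← hμ, eP, eQ, eP2, eQ2, ← integral_sub iP iQ, ← integral_add iP2 iQ2,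
    ← integral_const_mul, ← integral_const_mul, ← integral_div,
    ← integral_add ((iH.const_mul _).const_mul _) iS]
  refine integral_mono (iP.sub iQ) (((iH.const_mul _).const_mul _).add iS)
    fun z => ?_
  have := mul_sub_le_of_nonneg (f := f z) (ENNReal.toReal_nonneg (a := P.rnDeriv μ z))
    (ENNReal.toReal_nonneg (a := Q.rnDeriv μ z)) hc
  dsimp only
  linarith

/-- Two-sided change of measure where only the second moment under `Q` enters. -/
theorem abs_integral_sub_integral_le_sqHellinger {Z : Type*} [MeasurableSpace Z] (P Q : Measure Z)
    [IsProbabilityMeasure P] [IsProbabilityMeasure Q] {f : Z → ℝ} (hf : Measurable f)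
    (hf01 : ∀ z, f z ∈ Set.Icc (0 : ℝ) 1) {c : ℝ} (hc : 2 ≤ c) :
    |∫ z, f z ∂P - ∫ z, f z ∂Q| ≤
      2 * c * sqHellinger P Q + 4 * (∫ z, f z ^ 2 ∂Q) / c := by
  have hc0 : 0 < c := by linarith
  have hf2 : ∀ z, f z ^ 2 ∈ Set.Icc (0 : ℝ) 1 := fun z =>
    ⟨sq_nonneg _, pow_le_one₀ (hf01 z).1 (hf01 z).2⟩
  have hmono (ν : Measure Z) [IsProbabilityMeasure ν] :
      ∫ z, (f z ^ 2) ^ 2 ∂ν ≤ ∫ z, f z ^ 2 ∂ν := by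
    refine integral_mono_of_nonneg (.of_forall fun z => sq_nonneg _)
      (Integrable.of_mem_Icc 0 1 (hf.pow_const 2).aemeasurable (.of_forall hf2))
      (.of_forall fun z => ?_)
    exact pow_le_of_le_one (hf2 z).1 (hf2 z).2 two_ne_zero
  have h1 := integral_sub_integral_le_sqHellinger P Q hf hf01 hc0
  have h2 := integral_sub_integral_le_sqHellinger Q P hf hf01 hc0
  have h3 := integral_sub_integral_le_sqHellinger P Q (hf.pow_const 2) hf2 (c := 2) two_pos
  rw [sqHellinger_comm Q P, add_comm (∫ z, f z ^ 2 ∂Q)] at h2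
  have hS : ∫ z, f z ^ 2 ∂P + ∫ z, f z ^ 2 ∂Q ≤
      4 * sqHellinger P Q + 4 * ∫ z, f z ^ 2 ∂Q := by
    linarith [hmono P, hmono Q]
  have hH := sqHellinger_nonneg P Q
  have hSc : (∫ z, f z ^ 2 ∂P + ∫ z, f z ^ 2 ∂Q) / c ≤
      c * sqHellinger P Q + 4 * (∫ z, f z ^ 2 ∂Q) / c := by
    rw [div_le_iff₀ hc0, add_mul, div_mul_cancel₀ _ hc0.ne']
    nlinarith [mul_nonneg (by nlinarith : 0 ≤ c * c - 4) hH]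
  rw [abs_le]
  constructor <;> linarith

theorem Real.iInf_le_of_nonneg {ι : Sort*} {f : ι → ℝ} {c : ℝ} (hc : 0 ≤ c) (i : ι)
    (h : f i ≤ c) : ⨅ i, f i ≤ c := by
  by_cases hb : BddBelow (Set.range f)
  · exact (ciInf_le hb i).trans h
  · rwa [Real.iInf_of_not_bddBelow hb]

/-- A mixture of the uniform distribution with weights proportional to `v`. -/
theorem exists_probVec_ge {A : Type*} [Fintype A] [Nonempty A] {v : A → ℝ} (hv : ∀ a, 0 ≤ v a)
    {s : ℝ} (hs : 0 < s) (hvs : ∑ a, v a ≤ s) :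
    ∃ q : ProbVec A, ∀ a, 1 / (2 * (Fintype.card A : ℝ)) ≤ q.1 a ∧ v a / (2 * s) ≤ q.1 a := by
  have hn : (0 : ℝ) < Fintype.card A := by exact_mod_cast Fintype.card_pos
  have ht : (∑ a, v a) / (2 * s) ≤ 1 / 2 := by
    rw [div_le_iff₀ (by positivity)]
    linarith
  have hu : 1 / (2 * (Fintype.card A : ℝ)) ≤ (1 - (∑ a, v a) / (2 * s)) / Fintype.card A := by
    rw [← div_div]
    gcongr
    linarith
  have hu0 : 0 < 1 / (2 * (Fintype.card A : ℝ)) := by positivity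
  have hw (a : A) : 0 ≤ v a / (2 * s) := div_nonneg (hv a) (by positivity)
  refine ⟨⟨fun a => (1 - (∑ a, v a) / (2 * s)) / Fintype.card A + v a / (2 * s), fun a => ?_, ?_⟩,
    fun a => ⟨?_, ?_⟩⟩
  · linarith [hw a]
  · rw [Finset.sum_add_distrib, Finset.sum_const, Finset.card_univ, nsmul_eq_mul,
      mul_div_cancel₀ _ hn.ne', ← Finset.sum_div]
    ring
  · dsimp only
    linarith [hw a]
  · dsimp only
    linarith

/-- DEC bound for sparse models: for the class of all models with
`∑_a E_{o∼M(a)}[R(o)²] ≤ s`, the offset decision-estimation coefficient satisfies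
`p-dec_γ ≤ 64 s / γ` whenever `γ ≥ 32|A|`. -/
theorem pdec_sparse_le {A : Type*} [Fintype A] [Nonempty A]
    {O : Type*} [MeasurableSpace O]
    (R : O → ℝ) (hR : Measurable R) (hR01 : ∀ o, R o ∈ Set.Icc (0 : ℝ) 1)
    (s : ℝ) (hs : 0 < s) (γ : ℝ) (hγ : 32 * (Fintype.card A : ℝ) ≤ γ) :
    (⨆ Mbar : SparseModel (A := A) R s,
      ⨅ p : ProbVec A, ⨅ q : ProbVec A,
        ⨆ M : SparseModel (A := A) R s,
          ((∑ a, p.1 a * ((⨆ a' : A, ∫ o, R o ∂(M.1 a')) - ∫ o, R o ∂(M.1 a)))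
            - γ * ∑ a, q.1 a * sqHellinger (M.1 a) (Mbar.1 a)))
      ≤ 64 * s / γ := by
  classical
  have hn : (0 : ℝ) < Fintype.card A := by exact_mod_cast Fintype.card_pos
  have hγ0 : 0 < γ := by linarith
  have hB : 0 ≤ 64 * s / γ := by positivity
  refine Real.iSup_le (fun ⟨N, hN, hNs⟩ => ?_) hB
  obtain ⟨q, hq⟩ := exists_probVec_ge (fun a => integral_nonneg fun o => sq_nonneg (R o)) hs hNs
  obtain ⟨b, hb⟩ := Finite.exists_max fun a => ∫ o, R o ∂(N a)
  refine Real.iInf_le_of_nonneg hB ⟨Pi.single b 1, (Pi.single_nonneg.2 zero_le_one : (0 : A → ℝ) ≤ _), by simp⟩ ?_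
  refine Real.iInf_le_of_nonneg hB q (Real.iSup_le (fun ⟨M, hM, _⟩ => ?_) hB)
  obtain ⟨m, hm⟩ := exists_eq_ciSup_of_finite (f := fun a => ∫ o, R o ∂(M a))
  have hterm (a : A) : 0 ≤ q.1 a * sqHellinger (M a) (N a) :=
    mul_nonneg (q.2.1 a) (sqHellinger_nonneg _ _)
  have hdev (a : A) : |∫ o, R o ∂(M a) - ∫ o, R o ∂(N a)| ≤
      γ * (q.1 a * sqHellinger (M a) (N a)) + 16 * s / γ := by
    have := hM a
    have := hN a
    obtain ⟨hq1, hq2⟩ := hq a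
    have hq0 : 0 < q.1 a := lt_of_lt_of_le (by positivity) hq1
    have hc : 2 ≤ γ * q.1 a / 2 := by
      rw [div_le_iff₀ (by positivity)] at hq1
      nlinarith
    have hv : 4 * (∫ o, R o ^ 2 ∂(N a)) / (γ * q.1 a / 2) ≤ 16 * s / γ := by
      rw [div_le_iff₀ (by positivity)] at hq2 ⊢
      have : 16 * s / γ * (γ * q.1 a / 2) = 4 * (q.1 a * (2 * s)) := by
        field_simp
        ring
      linarith
    have := abs_integral_sub_integral_le_sqHellinger (M a) (N a) hR hR01 hc
    linarith
  simp only [Pi.single_apply, ite_mul, one_mul, zero_mul, Finset.sum_ite_eq', Finset.mem_univ,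
    if_true]
  rw [← hm]
  have h64 : 64 * s / γ = 2 * (16 * s / γ) + 32 * s / γ := by ring
  have h32 : 0 ≤ 32 * s / γ := by positivity
  by_cases hmb : m = b
  · have := mul_nonneg hγ0.le (Finset.sum_nonneg fun a (_ : a ∈ Finset.univ) => hterm a)
    rw [hmb]
    linarith
  · have hsum : q.1 m * sqHellinger (M m) (N m) + q.1 b * sqHellinger (M b) (N b) ≤
        ∑ a, q.1 a * sqHellinger (M a) (N a) :=
      Finset.add_le_sum (fun a _ => hterm a) (Finset.mem_univ m) (Finset.mem_univ b) hmb
    have h1 := (abs_le.1 (hdev m)).2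
    have h2 := (abs_le.1 (hdev b)).1
    have h3 := hb m
    have h4 := mul_le_mul_of_nonneg_left hsum hγ0.le
    linarith
end
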